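/- arXiv:2506.23708 — 5 statements merged into one kernel-verified Lean document; each statement's English description precedes it below -/
import Mathlib

section
/- Let I ⊆ [0,∞) be a set satisfying the descending chain condition and let Ω ⊆ (0,∞) be a finite set. Then the set J := { i ∈ I | there exist n ∈ ℤ_{≥0}, elements i_0, …, i_n ∈ I, a positive integer m, and nonnegative integers m_0, …, m_n such that m·i + ∑_{k=0}^n m_k·i_k ∈ Ω } is finite. -/
/-- A set of reals satisfies the descending chain condition (DCC) if it contains
no infinite strictly decreasing sequence. -/
def SetDCC (S : Set ℝ) : Prop := ¬ ∃ f : ℕ → ℝ, (∀ n, f n ∈ S) ∧ StrictAnti f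

theorem finite_of_dcc_and_finite_targets
    (I : Set ℝ) (hI : I ⊆ Set.Ici 0) (hIdcc : SetDCC I)
    (Ω : Set ℝ) (hΩ : Ω ⊆ Set.Ioi 0) (hΩfin : Ω.Finite) :
    {i ∈ I | ∃ (n : ℕ) (ι : Fin (n + 1) → ℝ), (∀ k, ι k ∈ I) ∧
      ∃ (m : ℕ), 0 < m ∧ ∃ ms : Fin (n + 1) → ℕ,
        (m : ℝ) * i + ∑ k, (ms k : ℝ) * ι k ∈ Ω}.Finite := by
  have hP : I.IsPWO := by
    rw [Set.isPWO_iff_isWF, Set.isWF_iff_no_descending_seq]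
    intro f hf hmem
    exact hIdcc ⟨f, fun n => hmem n, hf⟩
  have hC : (AddSubmonoid.closure I : Set ℝ).IsPWO :=
    Set.IsPWO.addSubmonoid_closure (fun x hx => hI hx) hP
  refine (hΩfin.biUnion (t := fun ω => Prod.fst '' Set.antidiagonal I
    (AddSubmonoid.closure I : Set ℝ) ω) fun ω _ =>
      (Set.AddAntidiagonal.finite_of_isPWO hP hC ω).image _).subset ?_
  rintro i ⟨hi, n, ι, hι, m, hm, ms, h⟩
  refine Set.mem_biUnion h ⟨(i, ((m - 1 : ℕ) : ℝ) * i + ∑ k, (ms k : ℝ) * ι k), ?_, rfl⟩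
  refine ⟨hi, ?_, ?_⟩
  · refine add_mem ?_ (sum_mem fun k _ => ?_)
    · rw [← nsmul_eq_mul]
      exact nsmul_mem (AddSubmonoid.subset_closure hi) _
    · rw [← nsmul_eq_mul]
      exact nsmul_mem (AddSubmonoid.subset_closure (hι k)) _
  · obtain ⟨p, rfl⟩ : ∃ p, m = p + 1 := ⟨m - 1, by omega⟩
    simp only [Nat.add_sub_cancel]
    push_cast
    ring
end

section
/- Let I ⊆ [0,∞) be a set satisfying the descending chain condition. Then the set I_+ := {0} ∪ { ∑_{k=1}^n i_k | n ∈ ℤ_{>0}, i_1, …, i_n ∈ I } also satisfies the descending chain condition. -/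
theorem dcc_of_finite_sums
    (I : Set ℝ) (hI : I ⊆ Set.Ici 0) (hIdcc : SetDCC I) :
    SetDCC ({0} ∪ {x : ℝ | ∃ (n : ℕ), 0 < n ∧ ∃ ι : Fin n → ℝ,
      (∀ k, ι k ∈ I) ∧ x = ∑ k, ι k}) := by
  have h1 : I.IsWF := by
    rw [Set.isWF_iff_no_descending_seq]
    intro f hf h
    exact hIdcc ⟨f, h, hf⟩
  have h2 := (Set.IsPWO.addSubmonoid_closure (fun x hx => hI hx) h1.isPWO).isWF
  rw [Set.isWF_iff_no_descending_seq] at h2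
  rintro ⟨f, hf, hanti⟩
  refine h2 f hanti fun n => ?_
  rcases hf n with h | ⟨m, -, g, hg, h⟩
  · rw [Set.mem_singleton_iff.1 h]
    exact zero_mem _
  · rw [h]
    exact sum_mem fun k _ => AddSubmonoid.subset_closure (hg k)
end

section
/- Let h : V → W be a linear map between finite-dimensional real vector spaces, and let C ⊆ V and D ⊆ W be closed strongly convex cones, each containing a nonzero point. Assume h(C) ⊆ D. Let R be an extremal ray of D that is contained in h(C). Then there exists an extremal ray R' of C such that h(R') = R. Moreover, for every linear functional L : W → ℝ with L(x) ≥ 0 for all x ∈ D: L vanishes identically on R if and only if the functional L∘h vanishes identically on R', and L(x) < 0 for all nonzero x ∈ R if and only if L(h(y)) < 0 for all nonzero y ∈ R'. -/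
/-- `IsConvexCone C` : `C` is a convex cone, i.e. closed under addition and
under multiplication by nonnegative scalars. -/
def IsConvexCone {V : Type*} [AddCommGroup V] [Module ℝ V] (C : Set V) : Prop :=
  (∀ x ∈ C, ∀ y ∈ C, x + y ∈ C) ∧ (∀ t : ℝ, 0 ≤ t → ∀ x ∈ C, t • x ∈ C)

/-- `IsRayOf C R` : `R` is a ray contained in `C`, i.e. `R = {t • v | 0 ≤ t}`
for some nonzero vector `v`, and `R ⊆ C`. -/
def IsRayOf {V : Type*} [AddCommGroup V] [Module ℝ V] (C R : Set V) : Prop :=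
  (∃ v : V, v ≠ 0 ∧ R = {x | ∃ t : ℝ, 0 ≤ t ∧ x = t • v}) ∧ R ⊆ C

/-- `IsExtremalRayOf C R` : `R` is an extremal ray of `C`. -/
def IsExtremalRayOf {V : Type*} [AddCommGroup V] [Module ℝ V] (C R : Set V) : Prop :=
  IsRayOf C R ∧ ∀ x ∈ C, ∀ y ∈ C, x + y ∈ R → x ∈ R ∧ y ∈ R

theorem exists_pos_functional {V : Type*} [NormedAddCommGroup V] [NormedSpace ℝ V]
    [FiniteDimensional ℝ V] (C : Set V) (hC : IsConvexCone C) (hcl : IsClosed C)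
    (hs : C ∩ (-C) = {0}) :
    ∃ (f : V →L[ℝ] ℝ) (c : ℝ), 0 < c ∧ ∀ x ∈ C, c * ‖x‖ ≤ f x := by
  have hK : IsCompact (C ∩ Metric.sphere (0 : V) 1) :=
    (isCompact_sphere (0 : V) 1).inter_left hcl
  by_cases hCe : C.Nonempty
  swap
  · exact ⟨0, 1, one_pos, fun x hx => absurd ⟨x, hx⟩ hCe⟩
  obtain ⟨x₀, hx₀⟩ := hCe
  have h0C : (0 : V) ∈ C := by simpa using hC.2 0 le_rfl x₀ hx₀
  have hconv : Convex ℝ C := fun x hx y hy a b ha hb _ =>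
    hC.1 _ (hC.2 a ha x hx) _ (hC.2 b hb y hy)
  have hsep : ∀ x : V, ∃ g : V →L[ℝ] ℝ, (∀ y ∈ C, 0 ≤ g y) ∧ (x ∈ C → x ≠ 0 → 0 < g x) := by
    intro x
    by_cases hx : x ∈ C ∧ x ≠ 0
    swap
    · exact ⟨0, by simp, fun h1 h2 => absurd ⟨h1, h2⟩ hx⟩
    have hnx : -x ∉ C := fun hn => by
      have h1 : x ∈ C ∩ (-C) := ⟨hx.1, hn⟩
      rw [hs] at h1
      exact hx.2 h1
    obtain ⟨g, u, hu, hg⟩ := geometric_hahn_banach_point_closed hconv hcl hnx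
    have hu0 : u < 0 := by simpa using hg 0 h0C
    rw [map_neg] at hu
    refine ⟨g, fun y hy => ?_, fun _ _ => by linarith⟩
    by_contra! hneg
    have h1 := hg ((u / g y) • y) (hC.2 _ (div_nonneg_of_nonpos hu0.le hneg.le) y hy)
    rw [map_smul, smul_eq_mul, div_mul_cancel₀ _ hneg.ne] at h1
    exact lt_irrefl _ h1
  choose g hg0 hgpos using hsep
  have hKne : ∀ x ∈ C ∩ Metric.sphere (0 : V) 1, x ≠ 0 := by
    rintro x ⟨-, hx⟩ rfl
    simp at hx
  obtain ⟨T, hT, hcov⟩ := hK.elim_nhds_subcover (fun x => {y | 0 < g x y}) (fun x hx =>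
    (isOpen_lt continuous_const (g x).continuous).mem_nhds (hgpos x hx.1 (hKne x hx)))
  have hfK : ∀ x ∈ C ∩ Metric.sphere (0 : V) 1, 0 < (∑ z ∈ T, g z) x := by
    intro x hx
    obtain ⟨z, hz, hzx⟩ := Set.mem_iUnion₂.1 (hcov hx)
    rw [ContinuousLinearMap.sum_apply]
    exact Finset.sum_pos' (fun z _ => hg0 z x hx.1) ⟨z, hz, hzx⟩
  obtain ⟨f, hfdef⟩ : ∃ f : V →L[ℝ] ℝ, f = ∑ z ∈ T, g z := ⟨_, rfl⟩
  rw [← hfdef] at hfK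
  obtain ⟨u, hu, hf⟩ : ∃ u : ℝ, 0 < u ∧ ∀ x ∈ C ∩ Metric.sphere (0 : V) 1, u ≤ f x := by
    rcases (C ∩ Metric.sphere (0 : V) 1).eq_empty_or_nonempty with hE | hN
    · exact ⟨1, one_pos, fun x hx => by rw [hE] at hx; exact absurd hx (Set.notMem_empty x)⟩
    · obtain ⟨m, hm, hmin⟩ := hK.exists_isMinOn hN f.continuous.continuousOn
      exact ⟨f m, hfK m hm, fun x hx => hmin hx⟩
  refine ⟨f, u, hu, fun x hx => ?_⟩
  by_cases hx0 : x = 0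
  · simp [hx0]
  have hn : 0 < ‖x‖ := norm_pos_iff.2 hx0
  have h2 := hf (‖x‖⁻¹ • x) ⟨hC.2 _ (by positivity) x hx, by
    simp [norm_smul, hn.ne']⟩
  rw [map_smul, smul_eq_mul, inv_mul_eq_div, le_div_iff₀ hn] at h2
  exact h2

theorem extremal_ray_pullback
    {V W : Type*} [NormedAddCommGroup V] [NormedSpace ℝ V] [FiniteDimensional ℝ V]
    [NormedAddCommGroup W] [NormedSpace ℝ W] [FiniteDimensional ℝ W]
    (h : V →ₗ[ℝ] W) (C : Set V) (D : Set W)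
    (hCcone : IsConvexCone C) (hCclosed : IsClosed C)
    (hCstrong : C ∩ (-C) = {0}) (hCne : ∃ x ∈ C, x ≠ 0)
    (hDcone : IsConvexCone D) (hDclosed : IsClosed D)
    (hDstrong : D ∩ (-D) = {0}) (hDne : ∃ x ∈ D, x ≠ 0)
    (himg : h '' C ⊆ D)
    (R : Set W) (hR : IsExtremalRayOf D R) (hRsub : R ⊆ h '' C) :
    ∃ R' : Set V, IsExtremalRayOf C R' ∧ h '' R' = R ∧
      ∀ L : W →ₗ[ℝ] ℝ, (∀ x ∈ D, 0 ≤ L x) →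
        ((∀ x ∈ R, L x = 0) ↔ (∀ y ∈ R', L (h y) = 0)) ∧
        ((∀ x ∈ R, x ≠ 0 → L x < 0) ↔ (∀ y ∈ R', y ≠ 0 → L (h y) < 0)) := by
  obtain ⟨f, c, hc, hf⟩ := exists_pos_functional C hCcone hCclosed hCstrong
  obtain ⟨⟨⟨w, hw, hRw⟩, hRD⟩, hRext⟩ := hR
  have hRclosed : IsClosed R := by
    have h1 := isClosedMap_smul_left (𝕜 := ℝ) w _ (isClosed_Ici (a := (0 : ℝ)))
    convert h1 using 1
    rw [hRw]
    ext x
    simp [eq_comm]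
  have hRadd : ∀ x ∈ R, ∀ y ∈ R, x + y ∈ R := by
    rw [hRw]
    rintro _ ⟨s, hs, rfl⟩ _ ⟨t, ht, rfl⟩
    exact ⟨s + t, by positivity, by rw [add_smul]⟩
  have hRsmul : ∀ a : ℝ, 0 ≤ a → ∀ x ∈ R, a • x ∈ R := by
    rw [hRw]
    rintro a ha _ ⟨t, ht, rfl⟩
    exact ⟨a * t, by positivity, by rw [mul_smul]⟩
  have hcont : Continuous h := h.continuous_of_finiteDimensional
  have hfpos : ∀ x ∈ C, x ≠ 0 → 0 < f x := fun x hx h0 =>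
    lt_of_lt_of_le (mul_pos hc (norm_pos_iff.2 h0)) (hf x hx)
  set B : Set V := C ∩ (h ⁻¹' R ∩ f ⁻¹' {1}) with hB
  have hBclosed : IsClosed B :=
    hCclosed.inter ((hRclosed.preimage hcont).inter (isClosed_singleton.preimage f.continuous))
  have hBcomp : IsCompact B := by
    refine Metric.isCompact_of_isClosed_isBounded hBclosed ?_
    refine isBounded_iff_forall_norm_le.2 ⟨c⁻¹, ?_⟩
    rintro x ⟨hx, -, hx1⟩
    have h1 := hf x hx
    rw [Set.mem_preimage, Set.mem_singleton_iff] at hx1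
    rw [hx1] at h1
    rw [← one_div, le_div_iff₀ hc]
    linarith
  have hBconv : Convex ℝ B := by
    rintro x ⟨hx, hxR, hx1⟩ y ⟨hy, hyR, hy1⟩ a b ha hb hab
    refine ⟨hCcone.1 _ (hCcone.2 a ha x hx) _ (hCcone.2 b hb y hy), ?_, ?_⟩
    · rw [Set.mem_preimage, map_add, map_smul, map_smul]
      exact hRadd _ (hRsmul a ha _ hxR) _ (hRsmul b hb _ hyR)
    · rw [Set.mem_preimage, Set.mem_singleton_iff] at *
      simp [hx1, hy1, hab]
  -- elements of C over R rescale into B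
  have hscale : ∀ x ∈ C, h x ∈ R → x ≠ 0 → (f x)⁻¹ • x ∈ B := by
    intro x hx hxR hx0
    have hp := hfpos x hx hx0
    refine ⟨hCcone.2 _ (by positivity) x hx, ?_, ?_⟩
    · rw [Set.mem_preimage, map_smul]
      exact hRsmul _ (by positivity) _ hxR
    · simp [hp.ne']
  have hex : ∃ e ∈ B.extremePoints ℝ, h e ≠ 0 := by
    by_contra! hcon
    have hker : B ⊆ (LinearMap.ker h : Set V) := by
      rw [← closure_convexHull_extremePoints hBcomp hBconv]
      refine closure_minimal (convexHull_min (fun e he => hcon e he)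
        (LinearMap.ker h).convex) (LinearMap.ker h).closed_of_finiteDimensional
    have hwR : w ∈ R := by
      rw [hRw]
      exact ⟨1, zero_le_one, by simp⟩
    obtain ⟨x, hx, hxw⟩ := hRsub hwR
    have hx0 : x ≠ 0 := by
      rintro rfl
      exact hw (by rw [← hxw, map_zero])
    have h1 := hker (hscale x hx (hxw ▸ hwR) hx0)
    have h2 : h ((f x)⁻¹ • x) = 0 := h1
    rw [map_smul, hxw, smul_eq_zero] at h2
    rcases h2 with h2 | h2
    · exact (inv_pos.2 (hfpos x hx hx0)).ne' h2
    · exact hw h2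
  obtain ⟨e, he, hhe⟩ := hex
  obtain ⟨⟨heC, heR, he1⟩, heext⟩ := he
  rw [Set.mem_preimage] at heR
  rw [Set.mem_preimage, Set.mem_singleton_iff] at he1
  have he0 : e ≠ 0 := by
    rintro rfl
    exact hhe (map_zero h)
  have himage : h '' {x | ∃ t : ℝ, 0 ≤ t ∧ x = t • e} = R := by
    apply Set.Subset.antisymm
    · rintro _ ⟨_, ⟨t, ht, rfl⟩, rfl⟩
      rw [map_smul]
      exact hRsmul t ht _ heR
    · rw [hRw] at heR ⊢
      obtain ⟨s, hs, hse⟩ := heR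
      have hs0 : s ≠ 0 := by
        rintro rfl
        exact hhe (by rw [hse, zero_smul])
      rintro _ ⟨t, ht, rfl⟩
      refine ⟨(t / s) • e, ⟨t / s, by positivity, rfl⟩, ?_⟩
      rw [map_smul, hse, smul_smul, div_mul_cancel₀ _ hs0]
  refine ⟨{x | ∃ t : ℝ, 0 ≤ t ∧ x = t • e}, ⟨⟨⟨e, he0, rfl⟩, ?_⟩, ?_⟩, himage, ?_⟩
  · rintro _ ⟨t, ht, rfl⟩
    exact hCcone.2 t ht e heC
  · rintro x hx y hy ⟨t, ht, hxy⟩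
    by_cases hx0 : x = 0
    · subst hx0
      rw [zero_add] at hxy
      exact ⟨⟨0, le_rfl, by simp⟩, ⟨t, ht, hxy⟩⟩
    by_cases hy0 : y = 0
    · subst hy0
      rw [add_zero] at hxy
      exact ⟨⟨t, ht, hxy⟩, ⟨0, le_rfl, by simp⟩⟩
    have hfx := hfpos x hx hx0
    have hfy := hfpos y hy hy0
    have hsum : f x + f y = t := by
      rw [← map_add, hxy, map_smul, he1, smul_eq_mul, mul_one]
    have htpos : 0 < t := by linarith
    have hR2 := hRext (h x) (himg ⟨x, hx, rfl⟩) (h y) (himg ⟨y, hy, rfl⟩) (by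
      rw [← map_add, hxy, map_smul]
      exact hRsmul t ht _ heR)
    have hxB := hscale x hx hR2.1 hx0
    have hyB := hscale y hy hR2.2 hy0
    have hkey : (f x)⁻¹ • x = e := by
      refine heext hxB hyB ⟨f x / t, f y / t, by positivity, by positivity, ?_, ?_⟩
      · rw [← add_div, hsum, div_self htpos.ne']
      · have e1 : f x / t * (f x)⁻¹ = t⁻¹ := by field_simp
        have e2 : f y / t * (f y)⁻¹ = t⁻¹ := by field_simp
        rw [smul_smul, smul_smul, e1, e2, ← smul_add, hxy, inv_smul_smul₀ htpos.ne']
    have hx' : x = f x • e := by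
      rw [← hkey, smul_inv_smul₀ hfx.ne']
    refine ⟨⟨f x, hfx.le, hx'⟩, ⟨f y, hfy.le, ?_⟩⟩
    have h3 : y = t • e - x := by rw [← hxy]; simp
    rw [h3, ← hsum, add_smul, ← hx']
    simp [← hsum, add_smul, he1]
    try rw [← hx']
    try simp
  · intro L _
    refine ⟨⟨?_, ?_⟩, ⟨?_, ?_⟩⟩
    · intro H y hy
      exact H _ (himage ▸ ⟨y, hy, rfl⟩)
    · intro H x hx
      rw [← himage] at hx
      obtain ⟨y, hy, rfl⟩ := hx
      exact H y hy
    · intro H y hy hy0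
      refine H _ (himage ▸ ⟨y, hy, rfl⟩) ?_
      obtain ⟨t, ht, rfl⟩ := hy
      rw [map_smul]
      exact smul_ne_zero (fun h0 => hy0 (by rw [h0, zero_smul])) hhe
    · intro H x hx hx0
      rw [← himage] at hx
      obtain ⟨y, hy, rfl⟩ := hx
      refine H y hy ?_
      rintro rfl
      exact hx0 (map_zero h)
end

section
/- Let I ⊆ [0,∞) be a set satisfying the descending chain condition and let Ω ⊆ (0,∞) be a finite set. Then the set { t ∈ (0,∞) | there exist a ∈ I ∪ {0} and b ∈ I with b > 0 such that a + t·b ∈ Ω } satisfies the ascending chain condition. -/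
/-- A set of reals satisfies the ascending chain condition (ACC) if it contains
no infinite strictly increasing sequence. -/
def SetACC (S : Set ℝ) : Prop := ¬ ∃ f : ℕ → ℝ, (∀ n, f n ∈ S) ∧ StrictMono f

theorem acc_of_affine_thresholds
    (I : Set ℝ) (hI : I ⊆ Set.Ici 0) (hIdcc : SetDCC I)
    (Ω : Set ℝ) (hΩ : Ω ⊆ Set.Ioi 0) (hΩfin : Ω.Finite) :
    SetACC {t : ℝ | t ∈ Set.Ioi 0 ∧
      ∃ a ∈ I ∪ {0}, ∃ b ∈ I, 0 < b ∧ a + t * b ∈ Ω} := by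
  rintro ⟨f, hf, hmono⟩
  have hW : I.IsPWO := by
    apply Set.IsWF.isPWO
    rw [Set.isWF_iff_no_descending_seq]
    intro g hg hmem
    exact hIdcc ⟨g, hmem, hg⟩
  have h0 : (I ∪ {0}).IsPWO := hW.union (Set.isPWO_singleton 0)
  have hN : ((fun x : ℝ => -x) '' Ω).IsPWO := (hΩfin.image _).isPWO
  have hP := (h0.prod hW).prod hN
  choose hpos a ha b hb hb0 hw using hf
  obtain ⟨m, n, hmn, h⟩ := hP (fun n => ⟨((a n, b n), -(a n + f n * b n)),
    ⟨⟨ha n, hb n⟩, ⟨_, hw n, rfl⟩⟩⟩)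
  obtain ⟨⟨h1, h2⟩, h3⟩ := h
  simp only at h1 h2 h3
  have ht := hmono hmn
  have hp : 0 < f n := hpos n
  have e1 : f m * b m < f n * b m := mul_lt_mul_of_pos_right ht (hb0 m)
  have e2 : f n * b m ≤ f n * b n := mul_le_mul_of_nonneg_left h2 hp.le
  linarith
end

section
/- Let K ⊆ [0,∞) be a set satisfying the descending chain condition. Then there exists a finite set J ⊆ ℝ, depending only on K, with the following property: whenever λ, q, m, n are nonnegative integers, p_1, …, p_q are positive integers, α_1, …, α_m, β_1, …, β_n ∈ K, and a_1, …, a_m, b_1, …, b_n are nonnegative integers satisfying λ/2 + ∑_{k=1}^q (p_k − 1)/p_k + ∑_{j=1}^m (α_j/2)·a_j + ∑_{l=1}^n (β_l/2)·b_l = 2, then α_j ∈ J for every index j with a_j > 0, and β_l ∈ J for every index l with b_l > 0. -/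
theorem aux_sum_mem (M : AddSubmonoid ℝ) {m : ℕ} (α : Fin m → ℝ) (a : Fin m → ℕ)
    (h : ∀ j, α j / 2 ∈ M) (s : Finset (Fin m)) : ∑ j ∈ s, (α j / 2) * (a j : ℝ) ∈ M := by
  refine M.sum_mem fun j _ => ?_
  have := M.nsmul_mem (h j) (a j)
  rwa [nsmul_eq_mul, mul_comm] at this

theorem aux_split (M : AddSubmonoid ℝ) {m : ℕ} (α : Fin m → ℝ) (a : Fin m → ℕ)
    (h : ∀ j, α j / 2 ∈ M) (j : Fin m) (hj : 0 < a j) :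
    ∃ r ∈ M, ∑ j, (α j / 2) * (a j : ℝ) = α j / 2 + r := by
  obtain ⟨c, hc⟩ : ∃ c, a j = c + 1 := ⟨a j - 1, by omega⟩
  refine ⟨c • (α j / 2) + ∑ i ∈ Finset.univ.erase j, (α i / 2) * (a i : ℝ),
    M.add_mem (M.nsmul_mem (h j) c) (aux_sum_mem M α a h _), ?_⟩
  rw [← Finset.add_sum_erase Finset.univ _ (Finset.mem_univ j), hc, nsmul_eq_mul]
  push_cast
  ring

theorem aux_isPWO (K : Set ℝ) (hKdcc : SetDCC K) : K.IsPWO := by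
  rw [Set.isPWO_iff_isWF, Set.isWF_iff_no_descending_seq]
  intro f hf hK
  exact hKdcc ⟨f, fun n => hK n, hf⟩

theorem aux_pp : (Set.range fun p : ℕ => (((p + 1 : ℕ) : ℝ) - 1) / ((p + 1 : ℕ) : ℝ)).IsPWO := by
  rw [← Set.image_univ]
  refine (Set.isPWO_of_wellQuasiOrderedLE _).image_of_monotone ?_
  intro x y hxy
  have : (x : ℝ) ≤ y := by exact_mod_cast hxy
  have hx : (0 : ℝ) ≤ x := by positivity
  have hy : (0 : ℝ) ≤ y := by positivity
  simp only
  push_cast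
  rw [div_le_div_iff₀ (by positivity) (by positivity)]
  nlinarith

theorem finite_coefficient_set_of_dcc
    (K : Set ℝ) (hK : K ⊆ Set.Ici 0) (hKdcc : SetDCC K) :
    ∃ J : Set ℝ, J.Finite ∧
      ∀ (lam q m n : ℕ) (p : Fin q → ℕ) (hp : ∀ k, 0 < p k)
        (α : Fin m → ℝ) (β : Fin n → ℝ) (a : Fin m → ℕ) (b : Fin n → ℕ),
        (∀ j, α j ∈ K) → (∀ l, β l ∈ K) →
        ((lam : ℝ) / 2 + (∑ k, ((p k : ℝ) - 1) / (p k : ℝ))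
          + (∑ j, (α j / 2) * (a j : ℝ)) + (∑ l, (β l / 2) * (b l : ℝ)) = 2) →
        (∀ j, 0 < a j → α j ∈ J) ∧ (∀ l, 0 < b l → β l ∈ J) := by
  set T : Set ℝ := insert (1 / 2 : ℝ)
    ((Set.range fun p : ℕ => (((p + 1 : ℕ) : ℝ) - 1) / ((p + 1 : ℕ) : ℝ)) ∪
      (fun x : ℝ => x / 2) '' K) with hT
  have hTp : T.IsPWO := by
    refine (aux_pp.union ((aux_isPWO K hKdcc).image_of_monotone ?_)).insert _
    intro x y hxy
    simp only
    linarith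
  have hT0 : ∀ x ∈ T, 0 ≤ x := by
    rintro x (rfl | ⟨p, rfl⟩ | ⟨y, hy, rfl⟩)
    · norm_num
    · simp only
      push_cast
      rw [add_sub_cancel_right]
      positivity
    · have : (0 : ℝ) ≤ y := hK hy
      simp only
      positivity
  have hM := hTp.addSubmonoid_closure hT0
  set M := AddSubmonoid.closure T with hMd
  have hTM : ∀ x ∈ T, x ∈ M := fun x hx => AddSubmonoid.subset_closure hx
  have hKT : ∀ x ∈ K, x / 2 ∈ T := fun x hx => Or.inr (Or.inr ⟨x, hx, rfl⟩)
  refine ⟨(fun z : ℝ × ℝ => 2 * z.1) '' {x : ℝ × ℝ | x.1 ∈ T ∧ x.2 ∈ (M : Set ℝ) ∧ x.1 + x.2 = 2},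
    (Set.AddAntidiagonal.finite_of_isPWO hTp hM 2).image _, ?_⟩
  intro lam q m n p hp α β a b hα hβ heq
  have key : ∀ x ∈ K, ∀ r ∈ M, x / 2 + r = 2 →
      x ∈ (fun z : ℝ × ℝ => 2 * z.1) '' {x : ℝ × ℝ | x.1 ∈ T ∧ x.2 ∈ (M : Set ℝ) ∧ x.1 + x.2 = 2} := by
    intro x hx r hr h
    refine ⟨(x / 2, r), ⟨hKT x hx, hr, h⟩, ?_⟩
    simp only
    ring
  have h1 : (lam : ℝ) / 2 ∈ M := by
    have := M.nsmul_mem (hTM (1 / 2) (Or.inl rfl)) lam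
    rwa [nsmul_eq_mul, mul_one_div] at this
  have h2 : (∑ k, ((p k : ℝ) - 1) / (p k : ℝ)) ∈ M := by
    refine M.sum_mem fun k _ => hTM _ (Or.inr (Or.inl ⟨p k - 1, ?_⟩))
    simp only
    rw [Nat.sub_add_cancel (hp k)]
  have hα' : ∀ j, α j / 2 ∈ M := fun j => hTM _ (hKT _ (hα j))
  have hβ' : ∀ j, β j / 2 ∈ M := fun j => hTM _ (hKT _ (hβ j))
  have h3 := aux_sum_mem M α a hα' Finset.univ
  have h4 := aux_sum_mem M β b hβ' Finset.univ
  constructor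
  · intro j hj
    obtain ⟨r, hr, h⟩ := aux_split M α a hα' j hj
    refine key _ (hα j) _ (M.add_mem (M.add_mem (M.add_mem h1 h2) hr) h4) ?_
    rw [h] at heq
    linarith
  · intro j hj
    obtain ⟨r, hr, h⟩ := aux_split M β b hβ' j hj
    refine key _ (hβ j) _ (M.add_mem (M.add_mem (M.add_mem h1 h2) h3) hr) ?_
    rw [h] at heq
    linarith
end
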